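/- arXiv:2512.22362 — 3 statements merged into one kernel-verified Lean document; each statement's English description precedes it below -/
import Mathlib

section
/- For every natural number n ≥ 1, C_C(n) = 3·C_C(n−1) + 6·C_B(n−1) + 3·C_D(n−1). -/
open Nat Finset

/-- `CA n`: number of words of length `3n` over a three-letter alphabet in which each
letter count is divisible by 3. -/
def CA (n : ℕ) : ℕ :=
  ∑ k ∈ Finset.Nat.antidiagonalTuple 3 n,
    (3 * n)! / ((3 * k 0)! * (3 * k 1)! * (3 * k 2)!)

/-- `CB n`: number of words of length `3n` over a three-letter alphabet in which each
letter count is `≡ 1 [MOD 3]`; `CB 0 = 0`. -/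
def CB (n : ℕ) : ℕ :=
  if n = 0 then 0 else
    ∑ k ∈ Finset.Nat.antidiagonalTuple 3 (n - 1),
      (3 * n)! / ((3 * k 0 + 1)! * (3 * k 1 + 1)! * (3 * k 2 + 1)!)

/-- `CC n`: number of words of length `3n` over a three-letter alphabet in which each
letter count is `≡ 2 [MOD 3]`; `CC 0 = CC 1 = 0`. -/
def CC (n : ℕ) : ℕ :=
  if n ≤ 1 then 0 else
    ∑ k ∈ Finset.Nat.antidiagonalTuple 3 (n - 2),
      (3 * n)! / ((3 * k 0 + 2)! * (3 * k 1 + 2)! * (3 * k 2 + 2)!)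

/-- `CD n`: number of words of length `3n` over a three-letter alphabet in which the three
letter counts are congruent to 0, 1 and 2 mod 3 in some order; `CD 0 = 0`. -/
def CD (n : ℕ) : ℕ :=
  if n = 0 then 0 else
    6 * ∑ k ∈ Finset.Nat.antidiagonalTuple 3 (n - 1),
      (3 * n)! / ((3 * k 0)! * (3 * k 1 + 1)! * (3 * k 2 + 2)!)

/-- The trinomially weighted sum `∑ m! / (i! j! k!) * f i j k` over `i + j + k = m`. -/
def trinomialSum (m : ℕ) (f : ℕ → ℕ → ℕ → ℕ) : ℕ :=
  ∑ x ∈ antidiagonal m, m.choose x.1 * ∑ y ∈ antidiagonal x.2, x.2.choose y.1 * f x.1 y.1 y.2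

theorem trinomialSum_succ (m : ℕ) (f : ℕ → ℕ → ℕ → ℕ) :
    trinomialSum (m + 1) f = trinomialSum m (fun i j k => f (i + 1) j k) +
      trinomialSum m (fun i j k => f i (j + 1) k) +
      trinomialSum m (fun i j k => f i j (k + 1)) := by
  have h := Finset.sum_antidiagonal_choose_succ_mul
    (fun i p => ∑ y ∈ antidiagonal p, p.choose y.1 * f i y.1 y.2) m
  have h2 (i p : ℕ) := Finset.sum_antidiagonal_choose_succ_mul (fun j k => f i j k) p
  simp only [Nat.cast_id] at h h2
  simp only [h2, mul_add, sum_add_distrib] at h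
  have h3 : ∀ x ∈ antidiagonal m, m.choose x.2 = m.choose x.1 := fun x hx =>
    Nat.choose_symm_of_eq_add (by have := HasAntidiagonal.mem_antidiagonal.1 hx; omega)
  have h4 (p : ℕ) : ∀ x ∈ antidiagonal p, p.choose x.2 = p.choose x.1 := fun x hx =>
    Nat.choose_symm_of_eq_add (by have := HasAntidiagonal.mem_antidiagonal.1 hx; omega)
  unfold trinomialSum
  rw [h]
  have e1 : ∀ (p : ℕ) (g : ℕ × ℕ → ℕ), ∑ x ∈ antidiagonal p, p.choose x.2 * g x
      = ∑ x ∈ antidiagonal p, p.choose x.1 * g x := fun p g =>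
    sum_congr rfl fun x hx => by rw [h4 p x hx]
  simp only [e1]
  ring

/-- The number of words of length `m` over three letters with letter counts congruent to
`a`, `b`, `c` modulo 3. -/
def residueCount (m : ℕ) (a b c : ZMod 3) : ℕ :=
  trinomialSum m fun i j k =>
    if (i : ZMod 3) = a ∧ (j : ZMod 3) = b ∧ (k : ZMod 3) = c then 1 else 0

theorem residueCount_succ (m : ℕ) (a b c : ZMod 3) :
    residueCount (m + 1) a b c =
      residueCount m (a - 1) b c + residueCount m a (b - 1) c + residueCount m a b (c - 1) := by
  simp only [residueCount, trinomialSum_succ, Nat.cast_add, Nat.cast_one, eq_sub_iff_add_eq]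

theorem residueCount_swap_left (m : ℕ) (a b c : ZMod 3) :
    residueCount m a b c = residueCount m b a c := by
  induction m generalizing a b c with
  | zero => simp [residueCount, trinomialSum, _root_.and_left_comm]
  | succ m ih =>
    rw [residueCount_succ, residueCount_succ m b, ih (a - 1), ih a (b - 1), ih a b]
    ring

theorem residueCount_swap_right (m : ℕ) (a b c : ZMod 3) :
    residueCount m a b c = residueCount m a c b := by
  induction m generalizing a b c with
  | zero => simp [residueCount, trinomialSum, _root_.and_comm]
  | succ m ih =>
    rw [residueCount_succ, residueCount_succ m a c, ih (a - 1), ih a (b - 1), ih a b]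
    ring

theorem residueCount_two_add_three (m : ℕ) :
    residueCount (m + 3) 2 2 2 = 3 * residueCount m 2 2 2 + 6 * residueCount m 1 1 1 +
      3 * (6 * residueCount m 0 1 2) := by
  have h1 : (2 : ZMod 3) - 1 = 1 := by decide
  have h2 : (1 : ZMod 3) - 1 = 0 := by decide
  have h3 : (0 : ZMod 3) - 1 = 2 := by decide
  simp only [residueCount_succ, h1, h2, h3]
  rw [residueCount_swap_right m 0 2 1, residueCount_swap_left m 1 0 2,
    residueCount_swap_right m 1 2 0, residueCount_swap_left m 1 0 2,
    residueCount_swap_left m 2 0 1, residueCount_swap_right m 0 2 1,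
    residueCount_swap_right m 2 1 0, residueCount_swap_left m 2 0 1,
    residueCount_swap_right m 0 2 1]
  ring

theorem sum_antidiagonalTuple_eq_residueCount (N a b c : ℕ) (ha : a < 3) (hb : b < 3)
    (hc : c < 3) (m : ℕ) (hm : m = 3 * N + a + b + c) :
    ∑ k ∈ Finset.Nat.antidiagonalTuple 3 N,
      m ! / ((3 * k 0 + a)! * (3 * k 1 + b)! * (3 * k 2 + c)!) = residueCount m a b c := by
  simp only [residueCount, trinomialSum, mul_sum]
  rw [sum_sigma']
  refine sum_of_injOn (fun k => ⟨(3 * k 0 + a, 3 * k 1 + b + (3 * k 2 + c)),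
    (3 * k 1 + b, 3 * k 2 + c)⟩) ?_ ?_ ?_ ?_
  · intro k _ l _ h
    simp only [Sigma.mk.injEq, Prod.mk.injEq, heq_eq_eq] at h
    funext i
    fin_cases i <;> simp <;> omega
  · intro k hk
    simp only [mem_coe, Nat.mem_antidiagonalTuple, Fin.sum_univ_three] at hk
    simp only [coe_sigma, Set.mem_sigma_iff, mem_coe, HasAntidiagonal.mem_antidiagonal, and_true]
    omega
  · rintro ⟨⟨i, p⟩, ⟨j, k⟩⟩ h hn
    simp only [mem_sigma, HasAntidiagonal.mem_antidiagonal] at h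
    have : ¬ ((i : ZMod 3) = a ∧ (j : ZMod 3) = b ∧ (k : ZMod 3) = c) := by
      simp only [ZMod.natCast_eq_natCast_iff']
      rintro ⟨h1, h2, h3⟩
      refine hn ⟨![i / 3, j / 3, k / 3], ?_, ?_⟩
      · simp only [mem_coe, Nat.mem_antidiagonalTuple, Fin.sum_univ_three]
        simp
        omega
      · have e1 : 3 * (i / 3) + a = i := by omega
        have e2 : 3 * (j / 3) + b = j := by omega
        have e3 : 3 * (k / 3) + c = k := by omega
        simp [e1, e2, e3, h.2]
    simp [this]
  · intro k hk
    simp only [Nat.mem_antidiagonalTuple, Fin.sum_univ_three] at hk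
    have h3 : (3 : ZMod 3) = 0 := by decide
    have e : m = 3 * k 0 + a + (3 * k 1 + b + (3 * k 2 + c)) := by omega
    simp only [Nat.cast_add, Nat.cast_mul, Nat.cast_ofNat, h3, zero_mul, zero_add, and_self,
      if_true, mul_one, e]
    apply Nat.div_eq_of_eq_mul_left (by positivity)
    have e1 := Nat.add_choose_mul_factorial_mul_factorial (3 * k 0 + a)
      (3 * k 1 + b + (3 * k 2 + c))
    have e2 := Nat.add_choose_mul_factorial_mul_factorial (3 * k 1 + b) (3 * k 2 + c)
    rw [← Nat.choose_symm_add] at e1 e2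
    rw [← e1, ← e2]
    ring

theorem CB_succ (n : ℕ) : CB (n + 1) = residueCount (3 * (n + 1)) 1 1 1 := by
  have h := sum_antidiagonalTuple_eq_residueCount n 1 1 1 (by simp) (by simp) (by simp)
    (3 * (n + 1)) (by omega)
  simpa [CB] using h

theorem CC_add_two (n : ℕ) : CC (n + 2) = residueCount (3 * (n + 2)) 2 2 2 := by
  have h := sum_antidiagonalTuple_eq_residueCount n 2 2 2 (by simp) (by simp) (by simp)
    (3 * (n + 2)) (by omega)
  simpa [CC] using h

theorem CD_succ (n : ℕ) : CD (n + 1) = 6 * residueCount (3 * (n + 1)) 0 1 2 := by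
  have h := sum_antidiagonalTuple_eq_residueCount n 0 1 2 (by simp) (by simp) (by simp)
    (3 * (n + 1)) (by omega)
  simpa [CD] using h

theorem stmt_11 (n : ℕ) (hn : 1 ≤ n) :
    CC n = 3 * CC (n - 1) + 6 * CB (n - 1) + 3 * CD (n - 1) := by
  match n, hn with
  | 1, _ => rfl
  | 2, _ => decide
  | n + 3, _ =>
    have h := residueCount_two_add_three (3 * (n + 2))
    rw [show n + 3 - 1 = n + 2 from rfl, CC_add_two (n + 1), CC_add_two n, CB_succ (n + 1),
      CD_succ (n + 1)]
    exact h
end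

section
/- The sequence C_A satisfies C_A(1) = 3, C_A(2) = 63, C_A(3) = 2187, and for every natural number n ≥ 4, C_A(n) = 27·(C_A(n−1) − C_A(n−2) + 27·C_A(n−3)). -/
open Nat Finset

/-- The range `{0, …, 3n}` split by residues modulo `3`. -/
lemma sum_range_three_mul_add_one {M : Type*} [AddCommMonoid M] (g : ℕ → M) (n : ℕ) :
    ∑ i ∈ range (3 * n + 1), g i =
      ∑ i ∈ range (n + 1), g (3 * i) + ∑ i ∈ range n, (g (3 * i + 1) + g (3 * i + 2)) := by
  induction n with
  | zero => simp
  | succ n ih =>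
    rw [show 3 * (n + 1) + 1 = 3 * n + 1 + 1 + 1 + 1 by ring, sum_range_succ, sum_range_succ,
      sum_range_succ, ih, sum_range_succ _ (n + 1), sum_range_succ (fun i => g (3 * i + 1) + _) n,
      mul_add_one]
    ac_rfl

/-- The cubic roots of unity filter applied to the binomial expansion of `(x + t) ^ (3 * n)`. -/
lemma sum_cubic_roots_add_pow {R : Type*} [CommRing R] {w : R} (hw : w ^ 2 + w + 1 = 0)
    (t : R) (n : ℕ) :
    (1 + t) ^ (3 * n) + (w + t) ^ (3 * n) + (w ^ 2 + t) ^ (3 * n) =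
      3 * ∑ i ∈ range (n + 1), t ^ (3 * (n - i)) * ((3 * n).choose (3 * i) : R) := by
  have h3 : w ^ 3 = 1 := by linear_combination (w - 1) * hw
  have h3i (i : ℕ) : w ^ (3 * i) = 1 := by rw [pow_mul, h3, one_pow]
  rw [add_pow, add_pow, add_pow, ← sum_add_distrib, ← sum_add_distrib,
    sum_range_three_mul_add_one, sum_eq_zero (s := range n), add_zero, mul_sum]
  rotate_left
  · intro i _
    simp only [one_pow, ← pow_mul, pow_add, mul_comm 2 (3 * i)]
    simp only [pow_mul _ (3 * i), h3i, one_pow]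
    linear_combination
      (t ^ (3 * n - (3 * i + 1)) * ((3 * n).choose (3 * i + 1) : R) +
        t ^ (3 * n - (3 * i + 2)) * ((3 * n).choose (3 * i + 2) : R) * (w ^ 2 - w + 1)) * hw
  · refine sum_congr rfl fun i _ => ?_
    rw [pow_right_comm, h3i, one_pow, one_pow, Nat.mul_sub]
    ring

/-- `CA` as a double sum of products of binomial coefficients. -/
lemma CA_eq_sum_choose (n : ℕ) :
    CA n = ∑ i ∈ range (n + 1), ∑ j ∈ range (n - i + 1),
      (3 * n).choose (3 * i) * (3 * (n - i)).choose (3 * j) := by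
  have factorial_div {i j k : ℕ} :
      (3 * (i + (j + k)))! / ((3 * i)! * (3 * j)! * (3 * k)!) =
        (3 * (i + (j + k))).choose (3 * i) * (3 * (j + k)).choose (3 * j) := by
    apply Nat.div_eq_of_eq_mul_left (by positivity)
    have h₁ := Nat.add_choose_mul_factorial_mul_factorial (3 * (j + k)) (3 * i)
    have h₂ := Nat.add_choose_mul_factorial_mul_factorial (3 * k) (3 * j)
    rw [add_comm, ← mul_add] at h₁ h₂
    rw [← h₁, ← h₂]
    ring
  have h : CA n = ∑ p ∈ antidiagonal n, ∑ q ∈ antidiagonal p.2,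
      (3 * n)! / ((3 * p.1)! * (3 * q.1)! * (3 * q.2)!) := by
    rw [CA, sum_sigma']
    refine sum_nbij' (fun k => ⟨(k 0, k 1 + k 2), (k 1, k 2)⟩)
      (fun x => ![x.1.1, x.2.1, x.2.2]) ?_ ?_ ?_ ?_ ?_
    · intro k hk
      simpa [Finset.Nat.mem_antidiagonalTuple, Fin.sum_univ_three, add_assoc] using hk
    · rintro ⟨⟨a, b⟩, c, d⟩ hx
      simp only [mem_sigma, HasAntidiagonal.mem_antidiagonal] at hx
      simp [Finset.Nat.mem_antidiagonalTuple, Fin.sum_univ_three, add_assoc, hx.1, hx.2]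
    · intro k _
      ext i
      fin_cases i <;> rfl
    · rintro ⟨⟨a, b⟩, c, d⟩ hx
      simp only [mem_sigma, HasAntidiagonal.mem_antidiagonal] at hx
      simp [hx.2]
    · intro k _
      rfl
  rw [h, Finset.Nat.sum_antidiagonal_eq_sum_range_succ_mk]
  refine sum_congr rfl fun i hi => ?_
  rw [Finset.Nat.sum_antidiagonal_eq_sum_range_succ_mk]
  refine sum_congr rfl fun j hj => ?_
  rw [mem_range] at hi hj
  obtain ⟨k, rfl⟩ : ∃ k, n = i + (j + k) := ⟨n - i - j, by omega⟩
  simpa using factorial_div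

/-- Closed form of `CA` in terms of a primitive cubic root of unity `w`. -/
lemma nine_mul_CA {R : Type*} [CommRing R] {w : R} (hw : w ^ 2 + w + 1 = 0) (n : ℕ) :
    (9 * CA n : R) = 27 ^ n + 3 * (3 + 6 * w) ^ n + 3 * (-(3 + 6 * w)) ^ n + 2 * 0 ^ n := by
  have h : (9 * CA n : R) =
      ((1 + (1 + 1)) ^ (3 * n) + (w + (1 + 1)) ^ (3 * n) + (w ^ 2 + (1 + 1)) ^ (3 * n)) +
      ((1 + (w + 1)) ^ (3 * n) + (w + (w + 1)) ^ (3 * n) + (w ^ 2 + (w + 1)) ^ (3 * n)) +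
      ((1 + (w ^ 2 + 1)) ^ (3 * n) + (w + (w ^ 2 + 1)) ^ (3 * n) +
        (w ^ 2 + (w ^ 2 + 1)) ^ (3 * n)) := by
    rw [sum_cubic_roots_add_pow hw, sum_cubic_roots_add_pow hw, sum_cubic_roots_add_pow hw,
      ← mul_add, ← mul_add, ← sum_add_distrib, ← sum_add_distrib, CA_eq_sum_choose]
    simp only [← add_mul, sum_cubic_roots_add_pow hw]
    push_cast
    simp only [mul_sum, sum_mul, one_pow]
    refine sum_congr rfl fun i _ => sum_congr rfl fun j _ => ?_
    ring
  have hw2 : w ^ 2 = -w - 1 := by linear_combination hw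
  rw [h, hw2]
  simp only [pow_mul]
  rw [show (1 + (1 + 1) : R) ^ 3 = 27 by norm_num,
    show (w + (1 + 1)) ^ 3 = 3 + 6 * w by linear_combination (w + 5) * hw,
    show (w + (w + 1)) ^ 3 = -(3 + 6 * w) by linear_combination (8 * w + 4) * hw,
    show (-w - 1 + (1 + 1)) ^ 3 = -(3 + 6 * w) by linear_combination (-w + 4) * hw,
    show (1 + (w + 1)) ^ 3 = 3 + 6 * w by linear_combination (w + 5) * hw,
    show (-w - 1 + (w + 1)) ^ 3 = 0 by ring,
    show (1 + (-w - 1 + 1)) ^ 3 = -(3 + 6 * w) by linear_combination (-w + 4) * hw,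
    show (w + (-w - 1 + 1)) ^ 3 = 0 by ring,
    show (-w - 1 + (-w - 1 + 1)) ^ 3 = 3 + 6 * w by linear_combination (-8 * w - 4) * hw]
  ring

theorem stmt_13 :
    CA 1 = 3 ∧ CA 2 = 63 ∧ CA 3 = 2187 ∧
    ∀ n : ℕ, 4 ≤ n →
      (CA n : ℤ) = 27 * ((CA (n - 1) : ℤ) - CA (n - 2) + 27 * CA (n - 3)) := by
  refine ⟨by simp [CA_eq_sum_choose, sum_range_succ],
    by simp [CA_eq_sum_choose, sum_range_succ, Nat.choose],
    by simp [CA_eq_sum_choose, sum_range_succ, Nat.choose], fun n hn => ?_⟩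
  obtain ⟨m, rfl⟩ := Nat.exists_eq_add_of_le' hn
  obtain ⟨w, hw⟩ : ∃ w : ℂ, w ^ 2 + w + 1 = 0 := by
    obtain ⟨w, hw⟩ := IsAlgClosed.exists_pow_nat_eq (-3 : ℂ) two_pos
    exact ⟨(w - 1) / 2, by linear_combination hw / 4⟩
  have key : (CA (m + 4) : ℂ) = 27 * (CA (m + 3) - CA (m + 2) + 27 * CA (m + 1)) := by
    have hs : (3 + 6 * w) ^ 2 = -27 := by linear_combination 36 * hw
    generalize hsw : 3 + 6 * w = s at hs
    have h (k : ℕ) := hsw ▸ nine_mul_CA hw k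
    have h₁ := h (m + 1)
    have h₂ := h (m + 2)
    have h₃ := h (m + 3)
    have h₄ := h (m + 4)
    simp only [pow_add _ m, ne_eq, OfNat.ofNat_ne_zero, one_ne_zero, not_false_eq_true, zero_pow,
      mul_zero, add_zero] at h₁ h₂ h₃ h₄
    linear_combination (h₄ - 27 * h₃ + 27 * h₂ - 729 * h₁) / 9 +
      (s ^ m * s * (s - 27) + (-s) ^ m * s * (s + 27)) / 3 * hs
  exact_mod_cast key
end

section
/- For every natural number n ≥ 1, the following identity holds in the complex numbers: C_A(n) = (1/9)·x1^n + (1/3)·x2^n + (1/3)·x3^n, where x1 = 27, x2 = 3^(3/2)·i, and x3 = −3^(3/2)·i are the three roots of the polynomial x³ − 27(x² − x + 27). -/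
open Nat Finset

/-- The sum of the `k`-th powers of the three cube roots of unity. -/
theorem sum_pow_cube_root {w : ℂ} (hw : w ^ 2 + w + 1 = 0) (k : ℕ) :
    ∑ a ∈ range 3, (w ^ a) ^ k = if 3 ∣ k then 3 else 0 := by
  have h3 : w ^ 3 = 1 := by linear_combination (w - 1) * hw
  have hk : w ^ k = w ^ (k % 3) := by
    conv_lhs => rw [← Nat.div_add_mod k 3, pow_add, pow_mul, h3, one_pow, one_mul]
  simp only [← pow_mul, mul_comm _ k]
  simp only [pow_mul, hk, sum_range_succ, sum_range_zero]
  have hlt := Nat.mod_lt k (show 0 < 3 by norm_num)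
  simp only [Nat.dvd_iff_mod_eq_zero]
  interval_cases k % 3
  · norm_num
  · simp only [one_ne_zero, if_false]
    linear_combination hw
  · simp only [OfNat.ofNat_ne_zero, if_false]
    linear_combination (w ^ 2 - w + 1) * hw

/-- The roots of unity filter applied to the trinomial expansion. -/
theorem sum_cube_root_pow_eq_CA {w : ℂ} (hw : w ^ 2 + w + 1 = 0) (n : ℕ) :
    ∑ a ∈ range 3, ∑ b ∈ range 3, ∑ c ∈ range 3, (w ^ a + w ^ b + w ^ c) ^ (3 * n) =
      27 * (CA n : ℂ) := by
  have expand (x y z : ℂ) : (x + y + z) ^ (3 * n) =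
      ∑ k ∈ piAntidiag (univ : Finset (Fin 3)) (3 * n),
        (multinomial univ k : ℂ) * (x ^ k 0 * y ^ k 1 * z ^ k 2) := by
    have h := sum_pow_eq_sum_piAntidiag (univ : Finset (Fin 3)) ![x, y, z] (3 * n)
    simpa [Fin.sum_univ_three, Fin.prod_univ_three] using h
  have filter : ∑ a ∈ range 3, ∑ b ∈ range 3, ∑ c ∈ range 3,
      (w ^ a + w ^ b + w ^ c) ^ (3 * n) =
      ∑ k ∈ piAntidiag (univ : Finset (Fin 3)) (3 * n), (multinomial univ k : ℂ) *
        ((∑ a ∈ range 3, (w ^ a) ^ k 0) * (∑ a ∈ range 3, (w ^ a) ^ k 1) *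
          (∑ a ∈ range 3, (w ^ a) ^ k 2)) := by
    simp only [expand, sum_range_succ, sum_range_zero, zero_add, ← sum_add_distrib]
    refine sum_congr rfl fun k _ => ?_
    ring
  rw [filter, CA, Nat.cast_sum, mul_sum]
  simp only [sum_pow_cube_root hw]
  symm
  refine sum_of_injOn (fun k i => 3 * k i) ?_ ?_ ?_ ?_
  · intro k _ l _ h
    funext i
    have := congrFun h i
    simp only at this
    omega
  · intro k hk
    simp only [mem_coe, Finset.Nat.mem_antidiagonalTuple] at hk
    simp [← mul_sum, hk]
  · intro k hk hk'
    by_cases h : ∀ i, 3 ∣ k i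
    · choose l hl using h
      refine absurd ⟨l, ?_, ?_⟩ hk'
      · simp only [mem_piAntidiag, hl, ← mul_sum] at hk
        simp only [mem_coe, Finset.Nat.mem_antidiagonalTuple]
        omega
      · funext i
        exact (hl i).symm
    · have : ¬ (3 ∣ k 0 ∧ 3 ∣ k 1 ∧ 3 ∣ k 2) := by
        simpa [Fin.forall_fin_succ] using h
      split_ifs <;> simp_all
  · intro k hk
    rw [Finset.Nat.mem_antidiagonalTuple] at hk
    simp only [multinomial, ← mul_sum, hk, Fin.prod_univ_three, dvd_mul_right, if_true]
    ring

/-- Summing a function of `x i + x j + x k` over ordered triples groups by multisets. -/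
theorem sum_range_three_apply_add (g : ℂ → ℂ) (x : ℕ → ℂ) :
    ∑ a ∈ range 3, ∑ b ∈ range 3, ∑ c ∈ range 3, g (x a + x b + x c) =
      g (x 0 + x 0 + x 0) + g (x 1 + x 1 + x 1) + g (x 2 + x 2 + x 2) +
      6 * g (x 0 + x 1 + x 2) + 3 * g (x 0 + x 0 + x 1) +
      3 * g (x 1 + x 1 + x 2) + 3 * g (x 2 + x 2 + x 0) +
      3 * g (x 0 + x 0 + x 2) + 3 * g (x 1 + x 1 + x 0) +
      3 * g (x 2 + x 2 + x 1) := by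
  simp only [sum_range_succ, sum_range_zero, zero_add]
  ring_nf

theorem stmt_17 (n : ℕ) (hn : 1 ≤ n) :
    let x1 : ℂ := 27
    let x2 : ℂ := 3 * Real.sqrt 3 * Complex.I
    let x3 : ℂ := -(3 * Real.sqrt 3 * Complex.I)
    (x1 ^ 3 - 27 * (x1 ^ 2 - x1 + 27) = 0) ∧
    (x2 ^ 3 - 27 * (x2 ^ 2 - x2 + 27) = 0) ∧
    (x3 ^ 3 - 27 * (x3 ^ 2 - x3 + 27) = 0) ∧
    (CA n : ℂ) = (1 / 9) * x1 ^ n + (1 / 3) * x2 ^ n + (1 / 3) * x3 ^ n := by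
  intro x1 x2 x3
  have hs : (Real.sqrt 3 : ℂ) ^ 2 = 3 := by
    rw [← Complex.ofReal_pow, Real.sq_sqrt (by norm_num)]
    norm_num
  have hx2 : x2 ^ 2 = -27 := by
    linear_combination 9 * Complex.I ^ 2 * hs + 27 * Complex.I_sq
  have hx3 : x3 = -x2 := rfl
  have hx1 : x1 = 27 := rfl
  clear_value x1 x2 x3
  subst hx1 hx3
  refine ⟨by norm_num, by linear_combination (x2 - 27) * hx2,
    by linear_combination (-x2 - 27) * hx2, ?_⟩
  obtain ⟨w, hw⟩ : ∃ w : ℂ, x2 = 3 * (2 * w + 1) := ⟨(x2 / 3 - 1) / 2, by ring⟩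
  subst hw
  have hw : w ^ 2 + w + 1 = 0 := by linear_combination hx2 / 36
  have h3 : w ^ 3 = 1 := by linear_combination (w - 1) * hw
  have key := sum_cube_root_pow_eq_CA hw n
  have hn' : 3 * n ≠ 0 := by omega
  have e000 : (1 + 1 + 1 : ℂ) ^ (3 * n) = 27 ^ n := by
    rw [pow_mul]; norm_num
  have e111 : (w + w + w) ^ (3 * n) = 27 ^ n := by
    rw [pow_mul]; congr 1; linear_combination 27 * h3
  have e222 : (w ^ 2 + w ^ 2 + w ^ 2) ^ (3 * n) = 27 ^ n := by
    rw [pow_mul]; congr 1; linear_combination 27 * (w ^ 3 + 1) * h3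
  have e012 : (1 + w + w ^ 2) ^ (3 * n) = 0 := by
    rw [show 1 + w + w ^ 2 = 0 by linear_combination hw, zero_pow hn']
  have pos (x : ℂ) (hx : x ^ 3 = 1) :
      (x + x + w * x) ^ (3 * n) = (3 * (2 * w + 1)) ^ n := by
    rw [pow_mul]; congr 1
    linear_combination (2 + w) ^ 3 * hx + (w + 5) * hw
  have neg (x : ℂ) (hx : x ^ 3 = 1) :
      (x + x + w ^ 2 * x) ^ (3 * n) = (-(3 * (2 * w + 1))) ^ n := by
    rw [pow_mul]; congr 1
    linear_combination (2 + w ^ 2) ^ 3 * hx + (w ^ 4 - w ^ 3 + 6 * w ^ 2 - 5 * w + 11) * hw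
  have hw2 : (w ^ 2) ^ 3 = 1 := by rw [← pow_mul, mul_comm, pow_mul, h3, one_pow]
  have e001 := pos 1 (one_pow 3)
  have e112 := pos w h3
  have e220 := pos (w ^ 2) hw2
  have e002 := neg 1 (one_pow 3)
  have e110 := neg w h3
  have e221 := neg (w ^ 2) hw2
  rw [mul_one] at e001 e002
  rw [← sq] at e112
  rw [show w * w ^ 2 = 1 by linear_combination h3] at e220
  rw [show w ^ 2 * w = 1 by linear_combination h3] at e110
  rw [show w ^ 2 * w ^ 2 = w by linear_combination w * h3] at e221
  have total := sum_range_three_apply_add (· ^ (3 * n)) (w ^ ·)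
  simp only [pow_zero, pow_one] at total
  rw [key, e000, e111, e222, e012, e001, e112, e220, e002, e110, e221] at total
  linear_combination total / 27
end
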